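/- Let L be a complete lattice and let K ⊆ L be closed under arbitrary infima and arbitrary suprema (so ⊥, ⊤ ∈ K). Let E : ℝ → L be a spectral family, i.e. monotone (λ ≤ μ implies E(λ) ≤ E(μ)) and right-continuous (E(λ) = ⨅_{μ > λ} E(μ) for all λ). Then: (i) the map λ ↦ δᶦ_K(E(λ)) is monotone, right-continuous, and takes values in K; (ii) the map λ ↦ ⨅_{μ > λ} δᵒ_K(E(μ)) is monotone, right-continuous, and takes values in K; (iii) δᶦ_K(E(λ)) = ⊥ whenever E(λ) = ⊥, and δᶦ_K(E(λ)) = ⊤ whenever E(λ) = ⊤. -/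

import Mathlib

/-- Outer daseinisation of `a` to `K` in a complete lattice:
`δᵒ_K(a) := sInf {k ∈ K | a ≤ k}`. -/
def outerDas {L : Type*} [CompleteLattice L] (K : Set L) (a : L) : L :=
  sInf {k ∈ K | a ≤ k}

/-- Inner daseinisation of `a` to `K` in a complete lattice:
`δᶦ_K(a) := sSup {k ∈ K | k ≤ a}`. -/
def innerDas {L : Type*} [CompleteLattice L] (K : Set L) (a : L) : L :=
  sSup {k ∈ K | k ≤ a}

section Daseinisation

variable {L : Type*} [CompleteLattice L] {K : Set L}

theorem innerDas_le (K : Set L) (a : L) : innerDas K a ≤ a :=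
  sSup_le fun _ hk => hk.2

theorem le_innerDas {k a : L} (hk : k ∈ K) (h : k ≤ a) : k ≤ innerDas K a :=
  le_sSup ⟨hk, h⟩

theorem innerDas_mono (K : Set L) : Monotone (innerDas K) := fun _ _ hab =>
  sSup_le_sSup fun _ hk => ⟨hk.1, hk.2.trans hab⟩

theorem innerDas_mem (hSup : ∀ S : Set L, S ⊆ K → sSup S ∈ K) (a : L) : innerDas K a ∈ K :=
  hSup _ fun _ hk => hk.1

theorem outerDas_mem (hInf : ∀ S : Set L, S ⊆ K → sInf S ∈ K) (a : L) : outerDas K a ∈ K :=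
  hInf _ fun _ hk => hk.1

theorem biInf_mem_of_sInf_mem {ι : Type*} (hInf : ∀ S : Set L, S ⊆ K → sInf S ∈ K)
    {s : Set ι} {f : ι → L} (hf : ∀ i ∈ s, f i ∈ K) : ⨅ i ∈ s, f i ∈ K := by
  rw [← sInf_image]
  exact hInf _ (Set.image_subset_iff.2 hf)

theorem monotone_biInf_Ioi {α : Type*} [Preorder α] (f : α → L) :
    Monotone fun t => ⨅ x ∈ Set.Ioi t, f x := fun _ _ hst =>
  biInf_mono fun _ hx => Set.Ioi_subset_Ioi hst hx

theorem biInf_Ioi_biInf_Ioi {α : Type*} [Preorder α] [DenselyOrdered α] (f : α → L) (t : α) :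
    ⨅ x ∈ Set.Ioi t, ⨅ y ∈ Set.Ioi x, f y = ⨅ y ∈ Set.Ioi t, f y := by
  apply le_antisymm
  · refine le_iInf₂ fun y hy => ?_
    obtain ⟨x, htx, hxy⟩ := exists_between (Set.mem_Ioi.1 hy)
    exact (iInf₂_le x htx).trans (iInf₂_le y hxy)
  · exact le_iInf₂ fun x hx => monotone_biInf_Ioi f (le_of_lt hx)

end Daseinisation

/-- De Groote's observation: if `E : ℝ → L` is a spectral family (monotone and
right-continuous) and `K` is closed under arbitrary infima and suprema, then
`λ ↦ δᶦ_K(E λ)` and `λ ↦ ⨅_{μ>λ} δᵒ_K(E μ)` are again spectral families with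
values in `K`; moreover `δᶦ_K(E λ)` is `⊥` (resp. `⊤`) whenever `E λ` is. -/
theorem daseinised_spectral_family {L : Type*} [CompleteLattice L] (K : Set L)
    (hInf : ∀ S : Set L, S ⊆ K → sInf S ∈ K)
    (hSup : ∀ S : Set L, S ⊆ K → sSup S ∈ K)
    (E : ℝ → L) (hEmono : Monotone E)
    (hErc : ∀ t : ℝ, E t = ⨅ μ ∈ Set.Ioi t, E μ) :
    (Monotone fun t : ℝ => innerDas K (E t)) ∧
    (∀ t : ℝ, innerDas K (E t) = ⨅ μ ∈ Set.Ioi t, innerDas K (E μ)) ∧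
    (∀ t : ℝ, innerDas K (E t) ∈ K) ∧
    (Monotone fun t : ℝ => ⨅ μ ∈ Set.Ioi t, outerDas K (E μ)) ∧
    (∀ t : ℝ, (⨅ μ ∈ Set.Ioi t, outerDas K (E μ)) =
        ⨅ ν ∈ Set.Ioi t, ⨅ μ ∈ Set.Ioi ν, outerDas K (E μ)) ∧
    (∀ t : ℝ, (⨅ μ ∈ Set.Ioi t, outerDas K (E μ)) ∈ K) ∧
    (∀ t : ℝ, E t = ⊥ → innerDas K (E t) = ⊥) ∧
    (∀ t : ℝ, E t = ⊤ → innerDas K (E t) = ⊤) := by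
  refine ⟨(innerDas_mono K).comp hEmono, fun t => le_antisymm ?_ ?_, fun t => innerDas_mem hSup _,
    monotone_biInf_Ioi _, fun t => (biInf_Ioi_biInf_Ioi _ t).symm,
    fun t => biInf_mem_of_sInf_mem hInf fun μ _ => outerDas_mem hInf _, fun t ht => ?_,
    fun t ht => ?_⟩
  · exact le_iInf₂ fun μ hμ => innerDas_mono K (hEmono (le_of_lt hμ))
  · refine le_innerDas (biInf_mem_of_sInf_mem hInf fun μ _ => innerDas_mem hSup _) ?_
    rw [hErc t]
    exact iInf₂_mono fun μ _ => innerDas_le K (E μ)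
  · exact le_bot_iff.1 (ht ▸ innerDas_le K (E t))
  · have hTop : (⊤ : L) ∈ K := sInf_empty (α := L) ▸ hInf ∅ (Set.empty_subset K)
    exact top_le_iff.1 (le_innerDas hTop ht.ge)
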